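/- arXiv:2512.05451 — 2 statements merged into one kernel-verified Lean document; each statement's English description precedes it below -/
import Mathlib

section
/- There exists a universal constant C' > 0 such that for every integer h ≥ 2, every positive integer d, every quantum state ρ on ℂ^d, and every Hermitian matrix O ∈ ℂ^{d×d}: ∫ |⟨v|O|v⟩ − m|^h dD(ρ)(v) ≤ (C'·h·‖O‖_HS / (d+1))^h, where m = ∫ ⟨v|O|v⟩ dD(ρ)(v). -/
open Matrix MeasureTheory
open scoped ComplexOrder

noncomputable section

/-- `⟨v|A|v⟩ = v† A v`. -/
def qexp {d : ℕ} (A : Matrix (Fin d) (Fin d) ℂ) (v : Fin d → ℂ) : ℂ :=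
  star v ⬝ᵥ A.mulVec v

/-- Squared ℓ²-norm of a vector of `ℂ^d`. -/
def norm2 {d : ℕ} (v : Fin d → ℂ) : ℝ := ∑ i, Complex.normSq (v i)

/-- `σ` is the uniform (unitarily invariant) probability measure on the unit sphere of `ℂ^d`,
viewed as a measure on `ℂ^d` supported on the sphere. -/
def IsUniformSphere (d : ℕ) (σ : Measure (Fin d → ℂ)) : Prop :=
  IsProbabilityMeasure σ ∧
  σ {v | norm2 v = 1}ᶜ = 0 ∧
  ∀ U : Matrix (Fin d) (Fin d) ℂ, U ∈ Matrix.unitaryGroup (Fin d) ℂ →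
    σ.map (fun v => U.mulVec v) = σ

/-- The outcome distribution `D(ρ)` of the uniform POVM on a state `ρ`. -/
def uniformPOVMDist (d : ℕ) (σ : Measure (Fin d → ℂ))
    (ρ : Matrix (Fin d) (Fin d) ℂ) : Measure (Fin d → ℂ) :=
  σ.withDensity (fun v => ENNReal.ofReal ((d : ℝ) * (qexp ρ v).re))

/-- Hilbert–Schmidt (Frobenius) norm `√(Tr(A†A))`. -/
def hsNorm {d : ℕ} (A : Matrix (Fin d) (Fin d) ℂ) : ℝ :=
  Real.sqrt (((Aᴴ * A).trace).re)

lemma continuous_norm2 {d : ℕ} : Continuous (norm2 : (Fin d → ℂ) → ℝ) := by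
  unfold norm2
  exact continuous_finsetSum _ fun i _ => Complex.continuous_normSq.comp (continuous_apply i)

lemma norm_le_one_of_norm2_eq_one {d : ℕ} {v : Fin d → ℂ} (hv : norm2 v = 1) : ‖v‖ ≤ 1 := by
  refine (pi_norm_le_iff_of_nonneg zero_le_one).2 fun i => ?_
  have h : Complex.normSq (v i) ≤ 1 := by
    rw [← hv]
    exact Finset.single_le_sum (f := fun i => Complex.normSq (v i))
      (fun _ _ => Complex.normSq_nonneg _) (Finset.mem_univ i)
  rw [Complex.normSq_eq_norm_sq] at h
  nlinarith [norm_nonneg (v i)]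

namespace IsUniformSphere

variable {d : ℕ} {σ : Measure (Fin d → ℂ)}

lemma ae_norm2 (hσ : IsUniformSphere d σ) : ∀ᵐ v ∂σ, norm2 v = 1 := hσ.2.1

lemma ae_mem_closedBall (hσ : IsUniformSphere d σ) :
    ∀ᵐ v ∂σ, v ∈ Metric.closedBall (0 : Fin d → ℂ) 1 := by
  filter_upwards [hσ.ae_norm2] with v hv
  simpa using norm_le_one_of_norm2_eq_one hv

lemma integrable (hσ : IsUniformSphere d σ) {f : (Fin d → ℂ) → ℝ} (hf : Continuous f) :
    Integrable f σ := by
  have := hσ.1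
  rw [← Measure.restrict_eq_self_of_ae_mem hσ.ae_mem_closedBall]
  exact hf.continuousOn.integrableOn_compact (isCompact_closedBall _ _)

lemma integral_comp_mulVec (hσ : IsUniformSphere d σ) {U : Matrix (Fin d) (Fin d) ℂ}
    (hU : U ∈ Matrix.unitaryGroup (Fin d) ℂ) {f : (Fin d → ℂ) → ℝ} (hf : Continuous f) :
    ∫ v, f (U.mulVec v) ∂σ = ∫ v, f v ∂σ := by
  have hc : Continuous fun v : Fin d → ℂ => U.mulVec v :=
    continuous_const.matrix_mulVec continuous_id
  conv_rhs => rw [← hσ.2.2 U hU]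
  rw [integral_map hc.aemeasurable hf.aestronglyMeasurable]

/-- A differentiable family of functions with constant integral has derivative of integral zero. -/
lemma integral_deriv_eq_zero (hσ : IsUniformSphere d σ) {F F' : ℝ → (Fin d → ℂ) → ℝ}
    (hF : ∀ t, Continuous (F t)) (hF' : Continuous fun x : ℝ × (Fin d → ℂ) => F' x.1 x.2)
    (hd : ∀ t v, HasDerivAt (fun s => F s v) (F' t v) t)
    (hconst : ∀ t, ∫ v, F t v ∂σ = ∫ v, F 0 v ∂σ) :
    ∫ v, F' 0 v ∂σ = 0 := by
  have := hσ.1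
  obtain ⟨C, hC⟩ := ((isCompact_closedBall (0 : ℝ) 1).prod
    (isCompact_closedBall (0 : Fin d → ℂ) 1)).exists_bound_of_continuousOn hF'.continuousOn
  have key := (hasDerivAt_integral_of_dominated_loc_of_deriv_le (μ := σ) (F := F) (F' := F')
    (x₀ := 0) (bound := fun _ => C) (Metric.ball_mem_nhds (0 : ℝ) one_pos)
    (Filter.Eventually.of_forall fun t => (hF t).aestronglyMeasurable)
    (hσ.integrable (hF 0))
    ((hF'.comp (Continuous.prodMk_right (0 : ℝ))).aestronglyMeasurable) ?_
    (integrable_const C) (Filter.Eventually.of_forall fun v t _ => hd t v)).2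
  · have h0 : (fun t => ∫ v, F t v ∂σ) = fun _ => ∫ v, F 0 v ∂σ := funext hconst
    rw [h0] at key
    exact key.unique (hasDerivAt_const _ _)
  · filter_upwards [hσ.ae_mem_closedBall] with v hv t ht
    exact hC (t, v) ⟨Metric.ball_subset_closedBall ht, hv⟩

end IsUniformSphere

/-- The rotation by the angle `t` in the plane of the coordinates `i`, `j`, with phase `u`. -/
def planeRotation {d : ℕ} (i j : Fin d) (u : ℂ) (t : ℝ) : Matrix (Fin d) (Fin d) ℂ :=
  1 + Matrix.single i i ((Real.cos t : ℂ) - 1) + Matrix.single j j ((Real.cos t : ℂ) - 1)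
    + Matrix.single i j (-(Real.sin t : ℂ) * u) + Matrix.single j i ((Real.sin t : ℂ) * star u)

lemma planeRotation_mem_unitaryGroup {d : ℕ} {i j : Fin d} (hij : i ≠ j) {u : ℂ}
    (hu : u * star u = 1) (t : ℝ) : planeRotation i j u t ∈ Matrix.unitaryGroup (Fin d) ℂ := by
  have hji := hij.symm
  rw [Matrix.mem_unitaryGroup_iff]
  simp only [planeRotation, star_eq_conjTranspose, conjTranspose_add, conjTranspose_one,
    conjTranspose_single, add_mul, mul_add, one_mul, mul_one, single_mul_single_same,
    single_mul_single_of_ne _ _ _ _ hij, single_mul_single_of_ne _ _ _ _ hji, star_sub, star_mul',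
    star_neg, star_one, Complex.star_def, Complex.conj_ofReal]
  simp only [Complex.star_def] at hu
  ext a b
  by_cases ha : a = i <;> by_cases ha' : a = j <;> by_cases hb : b = i <;> by_cases hb' : b = j <;>
    simp_all [single_apply, one_apply, eq_comm] <;>
    first
    | linear_combination -(1 + 2 * Complex.cos t - Complex.sin t ^ 2 - u * (starRingEnd ℂ) u) * hu
        - Complex.cos_sq_add_sin_sq (t : ℂ)
    | ring

lemma planeRotation_mulVec_fst {d : ℕ} {i j : Fin d} (hij : i ≠ j) (u : ℂ) (t : ℝ)
    (v : Fin d → ℂ) :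
    (planeRotation i j u t).mulVec v i = Real.cos t * v i - Real.sin t * u * v j := by
  simp [planeRotation, add_mulVec, single_mulVec, hij]
  ring

lemma planeRotation_mulVec_snd {d : ℕ} {i j : Fin d} (hij : i ≠ j) (u : ℂ) (t : ℝ)
    (v : Fin d → ℂ) :
    (planeRotation i j u t).mulVec v j = Real.sin t * star u * v i + Real.cos t * v j := by
  simp [planeRotation, add_mulVec, single_mulVec, hij.symm]
  ring

lemma planeRotation_mulVec_of_ne {d : ℕ} {i j a : Fin d} (hi : a ≠ i) (hj : a ≠ j) (u : ℂ) (t : ℝ)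
    (v : Fin d → ℂ) : (planeRotation i j u t).mulVec v a = v a := by
  simp [planeRotation, add_mulVec, single_mulVec, hi, hj]

/-- The diagonal quadratic form `∑ i, l i * |v i| ^ 2`. -/
def diagForm {d : ℕ} (l : Fin d → ℝ) (v : Fin d → ℂ) : ℝ := ∑ i, l i * Complex.normSq (v i)

@[fun_prop]
lemma continuous_normSq_apply {d : ℕ} (i : Fin d) :
    Continuous fun v : Fin d → ℂ => Complex.normSq (v i) :=
  Complex.continuous_normSq.comp (continuous_apply i)

@[fun_prop]
lemma continuous_diagForm {d : ℕ} (l : Fin d → ℝ) : Continuous (diagForm l) := by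
  unfold diagForm
  fun_prop

/-- The real part of the `(i, j)` coherence of `v`, with phase `u`. -/
def coherence {d : ℕ} (i j : Fin d) (u : ℂ) (v : Fin d → ℂ) : ℝ := (v i * star (u * v j)).re

@[fun_prop]
lemma continuous_coherence {d : ℕ} (i j : Fin d) (u : ℂ) : Continuous (coherence i j u) := by
  unfold coherence
  fun_prop

lemma diagForm_planeRotation {d : ℕ} {i j : Fin d} (hij : i ≠ j) {u : ℂ} (hu : u * star u = 1)
    (l : Fin d → ℝ) (t : ℝ) (v : Fin d → ℂ) :
    diagForm l ((planeRotation i j u t).mulVec v) = diagForm l v -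
      (l i - l j) * ((Complex.normSq (v i) - Complex.normSq (v j)) * Real.sin t ^ 2
        + 2 * (Real.cos t * Real.sin t) * coherence i j u v) := by
  have hu' : u.re ^ 2 + u.im ^ 2 = 1 := by
    have := congrArg Complex.re hu
    simpa [pow_two] using this
  rw [sub_eq_add_neg, ← sub_eq_iff_eq_add']
  unfold diagForm
  rw [← Finset.sum_sub_distrib, Fintype.sum_eq_add i j hij]
  · rw [planeRotation_mulVec_fst hij, planeRotation_mulVec_snd hij]
    have hcs := Real.cos_sq_add_sin_sq t
    generalize Real.cos t = c at *
    generalize Real.sin t = s at *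
    simp only [Complex.normSq_apply, coherence, Complex.sub_re, Complex.add_re, Complex.mul_re,
      Complex.mul_im, Complex.sub_im, Complex.add_im, Complex.ofReal_re, Complex.ofReal_im,
      Complex.star_def, Complex.conj_re, Complex.conj_im]
    generalize (v i).re = a at *
    generalize (v i).im = b at *
    generalize (v j).re = x at *
    generalize (v j).im = y at *
    generalize u.re = p at *
    generalize u.im = q at *
    linear_combination (l i * (a ^ 2 + b ^ 2) + l j * (x ^ 2 + y ^ 2)) * hcs
      + (l i * s ^ 2 * (x ^ 2 + y ^ 2) + l j * s ^ 2 * (a ^ 2 + b ^ 2)) * hu'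
  · rintro a ⟨hi, hj⟩
    rw [planeRotation_mulVec_of_ne hi hj, sub_self]

lemma coherence_planeRotation {d : ℕ} {i j : Fin d} (hij : i ≠ j) {u : ℂ} (hu : u * star u = 1)
    (t : ℝ) (v : Fin d → ℂ) :
    coherence i j u ((planeRotation i j u t).mulVec v) =
      coherence i j u v * (Real.cos t ^ 2 - Real.sin t ^ 2)
        + (Complex.normSq (v i) - Complex.normSq (v j)) * (Real.cos t * Real.sin t) := by
  have hu' : u.re ^ 2 + u.im ^ 2 = 1 := by
    have := congrArg Complex.re hu
    simpa [pow_two] using this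
  unfold coherence
  rw [planeRotation_mulVec_fst hij, planeRotation_mulVec_snd hij]
  generalize Real.cos t = c at *
  generalize Real.sin t = s at *
  simp only [Complex.normSq_apply, Complex.sub_re, Complex.add_re, Complex.mul_re,
    Complex.mul_im, Complex.sub_im, Complex.add_im, Complex.ofReal_re, Complex.ofReal_im,
    Complex.star_def, Complex.conj_re, Complex.conj_im]
  generalize (v i).re = a at *
  generalize (v i).im = b at *
  generalize (v j).re = x at *
  generalize (v j).im = y at *
  generalize u.re = p at *
  generalize u.im = q at *
  linear_combination (c * s * (a ^ 2 + b ^ 2) - c * s * (x ^ 2 + y ^ 2)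
    - s ^ 2 * (a * (p * x - q * y) + b * (p * y + q * x))) * hu'

lemma planeRotation_zero {d : ℕ} (i j : Fin d) (u : ℂ) : planeRotation i j u 0 = 1 := by
  simp [planeRotation]

namespace IsUniformSphere

variable {d : ℕ} {σ : Measure (Fin d → ℂ)}

lemma integral_sub_mul_diagForm_pow_of_phase (hσ : IsUniformSphere d σ) {i j : Fin d} (hij : i ≠ j)
    {u : ℂ} (hu : u * star u = 1) (l : Fin d → ℝ) (m : ℕ) :
    ∫ v, ((Complex.normSq (v i) - Complex.normSq (v j)) * diagForm l v ^ m
      - 2 * m * (l i - l j) * (coherence i j u v ^ 2 * diagForm l v ^ (m - 1))) ∂σ = 0 := by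
  let P : (Fin d → ℂ) → ℝ := fun v => Complex.normSq (v i) - Complex.normSq (v j)
  let q : (Fin d → ℂ) → ℝ := coherence i j u
  let Q : ℝ → (Fin d → ℂ) → ℝ := fun t v =>
    q v * (Real.cos t ^ 2 - Real.sin t ^ 2) + P v * (Real.cos t * Real.sin t)
  let Q' : ℝ → (Fin d → ℂ) → ℝ := fun t v =>
    q v * (-(4 * Real.cos t * Real.sin t)) + P v * (Real.cos t ^ 2 - Real.sin t ^ 2)
  let Y : ℝ → (Fin d → ℂ) → ℝ := fun t v =>
    diagForm l v - (l i - l j) * (P v * Real.sin t ^ 2 + 2 * (Real.cos t * Real.sin t) * q v)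
  let Y' : ℝ → (Fin d → ℂ) → ℝ := fun t v =>
    -((l i - l j) * (P v * (2 * Real.cos t * Real.sin t)
      + 2 * (Real.cos t ^ 2 - Real.sin t ^ 2) * q v))
  have hP : Continuous P := by fun_prop
  have hq : Continuous q := by fun_prop
  have key := hσ.integral_deriv_eq_zero (F := fun t v => Q t v * Y t v ^ m)
    (F' := fun t v => Q' t v * Y t v ^ m + Q t v * (m * Y t v ^ (m - 1) * Y' t v))
    (fun t => by fun_prop) (by fun_prop) (fun t v => ?_) (fun t => ?_)
  · rw [← key]
    refine integral_congr_ae (Filter.Eventually.of_forall fun v => ?_)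
    simp only [Q, Q', Y, Y', P, q, Real.sin_zero, Real.cos_zero]
    ring_nf
  · have hs := Real.hasDerivAt_sin t
    have hc := Real.hasDerivAt_cos t
    have hQ : HasDerivAt (fun s => Q s v) (Q' t v) t := by
      refine ((((hc.pow 2).sub (hs.pow 2)).const_mul (q v)).add
        ((hc.mul hs).const_mul (P v))).congr_deriv ?_
      simp only [Q']
      ring
    have hY : HasDerivAt (fun s => Y s v) (Y' t v) t := by
      refine (((((hs.pow 2).const_mul (P v)).add
        (((hc.mul hs).const_mul 2).mul_const (q v))).const_mul (l i - l j)).const_sub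
          (diagForm l v)).congr_deriv ?_
      simp only [Y']
      ring
    exact hQ.mul (hY.pow m)
  · have hF : ∀ t v, Q t v * Y t v ^ m = (fun w => q w * diagForm l w ^ m)
        ((planeRotation i j u t).mulVec v) := fun t v => by
      simp only [q, coherence_planeRotation hij hu, diagForm_planeRotation hij hu]
      rfl
    simp only [hF, planeRotation_zero, one_mulVec]
    exact hσ.integral_comp_mulVec (planeRotation_mem_unitaryGroup hij hu t)
      (f := fun w => q w * diagForm l w ^ m) (by fun_prop)

lemma integral_sub_mul_diagForm_pow (hσ : IsUniformSphere d σ) (i j : Fin d)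
    (l : Fin d → ℝ) (m : ℕ) :
    ∫ v, (Complex.normSq (v i) - Complex.normSq (v j)) * diagForm l v ^ m ∂σ =
      ∫ v, m * (l i - l j) * (Complex.normSq (v i) * Complex.normSq (v j))
        * diagForm l v ^ (m - 1) ∂σ := by
  rcases eq_or_ne i j with rfl | hij
  · simp
  have h1 := hσ.integral_sub_mul_diagForm_pow_of_phase hij (u := 1) (by simp) l m
  have hI := hσ.integral_sub_mul_diagForm_pow_of_phase hij (u := Complex.I) (by simp) l m
  have h := congrArg₂ (· + ·) h1 hI
  rw [← integral_add (hσ.integrable (by fun_prop)) (hσ.integrable (by fun_prop))] at h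
  rw [← sub_eq_zero, ← integral_sub (hσ.integrable (by fun_prop)) (hσ.integrable (by fun_prop))]
  have h2 := congrArg (fun x => 2⁻¹ * x) h
  simp only [← integral_const_mul, add_zero, mul_zero] at h2
  rw [← h2]
  refine integral_congr_ae (Filter.Eventually.of_forall fun v => ?_)
  simp only [coherence, Complex.normSq_apply, Complex.mul_re, Complex.mul_im, Complex.star_def,
    Complex.conj_re, Complex.conj_im, Complex.I_re, Complex.I_im, Complex.one_re, Complex.one_im]
  ring

/-- Recursion for the mixed moments of the diagonal forms with weights `l ^ k` and `l`. -/
lemma integral_diagForm_mul_pow (hσ : IsUniformSphere d σ) (l : Fin d → ℝ) (k m : ℕ) :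
    ((d : ℝ) + m) * ∫ v, diagForm (fun i => l i ^ k) v * diagForm l v ^ m ∂σ =
      (∑ i, l i ^ k) * ∫ v, diagForm l v ^ m ∂σ
        + m * ∫ v, diagForm (fun i => l i ^ (k + 1)) v * diagForm l v ^ (m - 1) ∂σ := by
  have h : ∫ v, ∑ i, ∑ j, l i ^ k *
        ((Complex.normSq (v i) - Complex.normSq (v j)) * diagForm l v ^ m) ∂σ =
      ∫ v, ∑ i, ∑ j, l i ^ k * (m * (l i - l j) * (Complex.normSq (v i) * Complex.normSq (v j))
        * diagForm l v ^ (m - 1)) ∂σ := by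
    rw [integral_finsetSum _ fun i _ => hσ.integrable (by fun_prop),
      integral_finsetSum _ fun i _ => hσ.integrable (by fun_prop)]
    refine Finset.sum_congr rfl fun i _ => ?_
    rw [integral_finsetSum _ fun i _ => hσ.integrable (by fun_prop),
      integral_finsetSum _ fun i _ => hσ.integrable (by fun_prop)]
    refine Finset.sum_congr rfl fun j _ => ?_
    rw [integral_const_mul, integral_const_mul, hσ.integral_sub_mul_diagForm_pow]
  have hL : ∀ v, norm2 v = 1 → ∑ i, ∑ j, l i ^ k *
      ((Complex.normSq (v i) - Complex.normSq (v j)) * diagForm l v ^ m) =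
      d * (diagForm (fun i => l i ^ k) v * diagForm l v ^ m)
        - (∑ i, l i ^ k) * diagForm l v ^ m := fun v hv => by
    have : ∀ i, ∑ j, l i ^ k * ((Complex.normSq (v i) - Complex.normSq (v j)) * diagForm l v ^ m)
        = d * (l i ^ k * Complex.normSq (v i) * diagForm l v ^ m)
          - l i ^ k * diagForm l v ^ m := fun i => by
      rw [← Finset.mul_sum, ← Finset.sum_mul, Finset.sum_sub_distrib,
        show ∑ j, Complex.normSq (v j) = 1 from hv]
      simp
      ring
    simp only [this, Finset.sum_sub_distrib, ← Finset.mul_sum, ← Finset.sum_mul]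
    rfl
  have hR : ∀ v, norm2 v = 1 → ∑ i, ∑ j, l i ^ k * (m * (l i - l j) *
      (Complex.normSq (v i) * Complex.normSq (v j)) * diagForm l v ^ (m - 1)) =
      m * (diagForm (fun i => l i ^ (k + 1)) v * diagForm l v ^ (m - 1))
        - m * (diagForm (fun i => l i ^ k) v * diagForm l v ^ m) := fun v hv => by
    rcases Nat.eq_zero_or_pos m with rfl | hm
    · simp
    have : ∀ i, ∑ j, l i ^ k * (m * (l i - l j) *
        (Complex.normSq (v i) * Complex.normSq (v j)) * diagForm l v ^ (m - 1))
        = m * (l i ^ (k + 1) * Complex.normSq (v i) * diagForm l v ^ (m - 1))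
          - m * (l i ^ k * Complex.normSq (v i) * diagForm l v ^ m) := fun i => by
      calc _ = ∑ j, (m * l i ^ (k + 1) * Complex.normSq (v i) * diagForm l v ^ (m - 1)
              * Complex.normSq (v j) - m * l i ^ k * Complex.normSq (v i) * diagForm l v ^ (m - 1)
              * (l j * Complex.normSq (v j))) := Finset.sum_congr rfl fun j _ => by ring
        _ = _ := by
          rw [Finset.sum_sub_distrib, ← Finset.mul_sum, ← Finset.mul_sum, ← norm2, hv, ← diagForm]
          obtain ⟨n, rfl⟩ := Nat.exists_eq_add_of_le' hm
          simp only [Nat.add_sub_cancel, pow_succ (diagForm l v)]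
          ring
    simp only [this, Finset.sum_sub_distrib, ← Finset.mul_sum, ← Finset.sum_mul]
    rfl
  rw [integral_congr_ae (hσ.ae_norm2.mono hL), integral_congr_ae (hσ.ae_norm2.mono hR),
    integral_sub (hσ.integrable (by fun_prop)) (hσ.integrable (by fun_prop)),
    integral_sub (hσ.integrable (by fun_prop)) (hσ.integrable (by fun_prop))] at h
  simp only [integral_const_mul] at h
  linear_combination h

end IsUniformSphere

lemma abs_sum_pow_le {ι : Type*} [Fintype ι] {l : ι → ℝ} {S : ℝ} (hS : 0 ≤ S)
    (hl : ∑ i, l i ^ 2 ≤ S ^ 2) {k : ℕ} (hk : 2 ≤ k) : |∑ i, l i ^ k| ≤ S ^ k := by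
  obtain ⟨n, rfl⟩ := Nat.exists_eq_add_of_le hk
  have hi : ∀ i, |l i| ≤ S := fun i => abs_le_of_sq_le_sq
    ((Finset.single_le_sum (f := fun i => l i ^ 2) (fun _ _ => sq_nonneg _)
      (Finset.mem_univ i)).trans hl) hS
  calc |∑ i, l i ^ (2 + n)| ≤ ∑ i, |l i ^ (2 + n)| := Finset.abs_sum_le_sum_abs _ _
    _ ≤ ∑ i, l i ^ 2 * S ^ n := Finset.sum_le_sum fun i _ => by
        rw [abs_pow, pow_add, sq_abs]
        exact mul_le_mul_of_nonneg_left (pow_le_pow_left₀ (abs_nonneg _) (hi i) n) (sq_nonneg _)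
    _ ≤ S ^ 2 * S ^ n := by
        rw [← Finset.sum_mul]
        exact mul_le_mul_of_nonneg_right hl (pow_nonneg hS n)
    _ = S ^ (2 + n) := (pow_add _ _ _).symm

namespace IsUniformSphere

variable {d : ℕ} {σ : Measure (Fin d → ℂ)}

lemma integral_diagForm_pow_succ (l : Fin d → ℝ) (m : ℕ) :
    ∫ v, diagForm l v ^ (m + 1) ∂σ =
      ∫ v, diagForm (fun i => l i ^ 1) v * diagForm l v ^ m ∂σ := by
  simp only [pow_one, pow_succ' (diagForm l _)]

/-- Joint induction for the moments of `l` and its mixed moments with the powers `l ^ k`. -/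
lemma abs_integral_diagForm_pow_le_aux (hσ : IsUniformSphere d σ) (hd : 0 < d) {l : Fin d → ℝ}
    {S : ℝ} (hS : 0 ≤ S) (h0 : ∑ i, l i = 0) (hl : ∑ i, l i ^ 2 ≤ S ^ 2) (m : ℕ) :
    (d : ℝ) ^ (m + 1) * |∫ v, diagForm l v ^ (m + 1) ∂σ| ≤ (m + 1).factorial * S ^ (m + 1) ∧
    ∀ k, 2 ≤ k → (d : ℝ) ^ (m + 1) * |∫ v, diagForm (fun i => l i ^ k) v * diagForm l v ^ m ∂σ| ≤
      (m + 1).factorial * S ^ (m + k) := by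
  have := hσ.1
  have hd' : (0 : ℝ) < d := Nat.cast_pos.2 hd
  have h1 : ∑ i, l i ^ 1 = 0 := by simpa using h0
  induction m with
  | zero =>
    refine ⟨?_, fun k hk => ?_⟩
    · have h := hσ.integral_diagForm_mul_pow l 1 0
      rw [← integral_diagForm_pow_succ, h1] at h
      have h' : ∫ v, diagForm l v ^ (0 + 1) ∂σ = 0 := by
        simpa [hd'.ne'] using h
      rw [h']
      simpa using hS
    · have h := hσ.integral_diagForm_mul_pow l k 0
      simp only [Nat.cast_zero, add_zero, zero_mul, pow_zero, integral_const, probReal_univ,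
        smul_eq_mul, mul_one] at h
      simp only [pow_zero, mul_one, zero_add, pow_one, Nat.factorial_one, Nat.cast_one, one_mul]
      have := abs_sum_pow_le hS hl hk
      rwa [← h, abs_mul, abs_of_pos hd'] at this
  | succ m ih =>
    obtain ⟨ihM, ihA⟩ := ih
    have hpos : (0 : ℝ) < d + ((m + 1 : ℕ) : ℝ) := by positivity
    have hle : (d : ℝ) ≤ d + ((m + 1 : ℕ) : ℝ) := le_add_of_nonneg_right (Nat.cast_nonneg _)
    have hfac : (((m + 1 + 1).factorial : ℕ) : ℝ) = (m + 2) * (m + 1).factorial := by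
      rw [Nat.factorial_succ]; push_cast; ring
    have step : ∀ A B : ℝ, (d + ((m + 1 : ℕ) : ℝ)) * A = B →
        (d : ℝ) ^ (m + 1 + 1) * |A| ≤ d ^ (m + 1) * |B| := fun A B h => by
      rw [← h, abs_mul, abs_of_pos hpos, pow_succ, mul_assoc]
      gcongr
    refine ⟨?_, fun k hk => ?_⟩
    · have h := hσ.integral_diagForm_mul_pow l 1 (m + 1)
      rw [← integral_diagForm_pow_succ, h1, zero_mul, zero_add, Nat.add_sub_cancel] at h
      have hA := ihA 2 le_rfl
      refine (step _ _ h).trans ?_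
      rw [abs_mul, abs_of_nonneg (Nat.cast_nonneg (m + 1)), hfac]
      push_cast
      have : (0 : ℝ) ≤ (m + 1).factorial * S ^ (m + 2) := by positivity
      have hm : (0 : ℝ) ≤ (m : ℝ) + 1 := by positivity
      have := mul_le_mul_of_nonneg_left hA hm
      simp only [show m + 1 + 1 = m + 2 from rfl]
      linarith
    · have h := hσ.integral_diagForm_mul_pow l k (m + 1)
      rw [Nat.add_sub_cancel] at h
      have hA := ihA (k + 1) (by omega)
      refine (step _ _ h).trans ?_
      have hp := abs_sum_pow_le hS hl hk
      have hm : (0 : ℝ) ≤ (m : ℝ) + 1 := by positivity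
      calc _ ≤ (d : ℝ) ^ (m + 1) * (S ^ k * |∫ v, diagForm l v ^ (m + 1) ∂σ| + (m + 1) *
            |∫ v, diagForm (fun i => l i ^ (k + 1)) v * diagForm l v ^ m ∂σ|) := by
            refine mul_le_mul_of_nonneg_left ((abs_add_le _ _).trans (add_le_add ?_ ?_))
              (by positivity)
            · rw [abs_mul]
              exact mul_le_mul_of_nonneg_right hp (abs_nonneg _)
            · rw [abs_mul, abs_of_nonneg (Nat.cast_nonneg (m + 1))]
              push_cast
              rfl
        _ = S ^ k * ((d : ℝ) ^ (m + 1) * |∫ v, diagForm l v ^ (m + 1) ∂σ|) + (m + 1) *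
            ((d : ℝ) ^ (m + 1) *
              |∫ v, diagForm (fun i => l i ^ (k + 1)) v * diagForm l v ^ m ∂σ|) := by ring
        _ ≤ S ^ k * ((m + 1).factorial * S ^ (m + 1))
            + (m + 1) * ((m + 1).factorial * S ^ (m + (k + 1))) := by gcongr
        _ = _ := by rw [hfac]; ring

/-- Moments of a traceless diagonal form on the uniform sphere. -/
lemma abs_integral_diagForm_pow_le (hσ : IsUniformSphere d σ) (hd : 0 < d) {l : Fin d → ℝ}
    {S : ℝ} (hS : 0 ≤ S) (h0 : ∑ i, l i = 0) (hl : ∑ i, l i ^ 2 ≤ S ^ 2) {n : ℕ} (hn : 0 < n) :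
    |∫ v, diagForm l v ^ n ∂σ| ≤ (n * S / d) ^ n := by
  obtain ⟨m, rfl⟩ := Nat.exists_eq_add_of_le' hn
  have h := (hσ.abs_integral_diagForm_pow_le_aux hd hS h0 hl m).1
  have hd' : (0 : ℝ) < d := Nat.cast_pos.2 hd
  rw [div_pow, le_div_iff₀ (by positivity), mul_comm, mul_pow]
  refine h.trans (mul_le_mul_of_nonneg_right ?_ (by positivity))
  exact_mod_cast Nat.factorial_le_pow (m + 1)

lemma integral_diagForm (hσ : IsUniformSphere d σ) (l : Fin d → ℝ) :
    d * ∫ v, diagForm l v ∂σ = ∑ i, l i := by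
  have := hσ.1
  simpa using hσ.integral_diagForm_mul_pow l 1 0

lemma integral_sq_diagForm_le (hσ : IsUniformSphere d σ) {l : Fin d → ℝ}
    (hnn : ∀ i, 0 ≤ l i) (h1 : ∑ i, l i = 1) :
    ∫ v, (d * diagForm l v) ^ 2 ∂σ ≤ 2 := by
  have := hσ.1
  have hX := hσ.integral_diagForm l
  have hP := hσ.integral_diagForm (fun i => l i ^ 2)
  have hXX := hσ.integral_diagForm_mul_pow l 1 1
  have hl : ∑ i, l i ^ 2 ≤ 1 := by
    rw [← h1]
    refine Finset.sum_le_sum fun i _ => ?_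
    have : l i ≤ 1 := h1 ▸ Finset.single_le_sum (fun i _ => hnn i) (Finset.mem_univ i)
    nlinarith [hnn i]
  simp only [pow_one, h1, one_mul, Nat.cast_one, Nat.sub_self, pow_zero, mul_one,
    one_add_one_eq_two] at hXX
  simp only [mul_pow, integral_const_mul, pow_two (diagForm l _)]
  have h0 : 0 ≤ ∫ v, diagForm l v * diagForm l v ∂σ := integral_nonneg fun v => mul_self_nonneg _
  have hd : (0 : ℝ) ≤ d := Nat.cast_nonneg d
  rw [h1] at hX
  have h2 := congrArg (fun x => (d : ℝ) * x) hXX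
  rw [mul_add (d : ℝ) (∫ v, diagForm l v ∂σ), hX, hP] at h2
  nlinarith [mul_nonneg hd h0]

end IsUniformSphere

lemma qexp_re_eq_diagForm_eigenvalues {d : ℕ} {A : Matrix (Fin d) (Fin d) ℂ} (hA : A.IsHermitian)
    (v : Fin d → ℂ) : (qexp A v).re =
      diagForm hA.eigenvalues ((star (hA.eigenvectorUnitary : Matrix (Fin d) (Fin d) ℂ)).mulVec v) := by
  set V := (hA.eigenvectorUnitary : Matrix (Fin d) (Fin d) ℂ) with hV
  have hspec : A = V * diagonal (RCLike.ofReal ∘ hA.eigenvalues) * star V := by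
    conv_lhs => rw [hA.spectral_theorem]
    rw [Unitary.conjStarAlgAut_apply]
  have h : qexp A v = star ((star V).mulVec v) ⬝ᵥ
      (diagonal (RCLike.ofReal ∘ hA.eigenvalues)).mulVec ((star V).mulVec v) := by
    rw [qexp]
    conv_lhs => rw [hspec]
    rw [← mulVec_mulVec, ← mulVec_mulVec, dotProduct_mulVec, star_mulVec, star_eq_conjTranspose,
      conjTranspose_conjTranspose]
  rw [h, diagForm, dotProduct, Complex.re_sum]
  refine Finset.sum_congr rfl fun i _ => ?_
  simp [mulVec_diagonal, Complex.normSq_apply]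
  ring

lemma sum_sq_eigenvalues {d : ℕ} {A : Matrix (Fin d) (Fin d) ℂ} (hA : A.IsHermitian) :
    ∑ i, hA.eigenvalues i ^ 2 = hsNorm A ^ 2 := by
  set V := (hA.eigenvectorUnitary : Matrix (Fin d) (Fin d) ℂ) with hV
  have hVV : star V * V = 1 := Unitary.coe_star_mul_self _
  have hspec : A = V * diagonal (RCLike.ofReal ∘ hA.eigenvalues) * star V := by
    conv_lhs => rw [hA.spectral_theorem]
    rw [Unitary.conjStarAlgAut_apply]
  have h : (Aᴴ * A).trace = ((∑ i, hA.eigenvalues i ^ 2 : ℝ) : ℂ) := by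
    rw [hA.eq]
    set D : Matrix (Fin d) (Fin d) ℂ := diagonal (RCLike.ofReal ∘ hA.eigenvalues) with hD
    have : A * A = V * (D * D * star V) := by
      calc A * A = V * D * (star V * V) * D * star V := by
            conv_lhs => rw [hspec]
            simp only [mul_assoc]
        _ = _ := by rw [hVV]; simp only [mul_assoc, one_mul]
    rw [this, trace_mul_comm, mul_assoc, hVV, mul_one, hD, diagonal_mul_diagonal, trace_diagonal]
    simp [pow_two]
  rw [hsNorm, h, Complex.ofReal_re, Real.sq_sqrt (Finset.sum_nonneg fun _ _ => sq_nonneg _)]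

@[fun_prop]
lemma continuous_qexp {d : ℕ} (A : Matrix (Fin d) (Fin d) ℂ) : Continuous (qexp A) := by
  unfold qexp
  exact continuous_star.dotProduct (continuous_const.matrix_mulVec continuous_id)

lemma diagForm_sub_const {d : ℕ} (l : Fin d → ℝ) (t : ℝ) {v : Fin d → ℂ} (hv : norm2 v = 1) :
    diagForm (fun i => l i - t) v = diagForm l v - t := by
  simp only [diagForm, sub_mul, Finset.sum_sub_distrib, ← Finset.mul_sum]
  rw [show ∑ i, Complex.normSq (v i) = 1 from hv, mul_one]

lemma sum_sub_mean {d : ℕ} (hd : 0 < d) (l : Fin d → ℝ) : ∑ i, (l i - (∑ j, l j) / d) = 0 := by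
  have hd' : (d : ℝ) ≠ 0 := by positivity
  simp [Finset.sum_sub_distrib, mul_div_cancel₀ _ hd']

lemma sum_sq_sub_mean_le {d : ℕ} (hd : 0 < d) (l : Fin d → ℝ) :
    ∑ i, (l i - (∑ j, l j) / d) ^ 2 ≤ ∑ i, l i ^ 2 := by
  set t := (∑ j, l j) / (d : ℝ) with ht
  have h0 := sum_sub_mean hd l
  rw [← ht] at h0
  have : ∑ i, l i ^ 2 = ∑ i, (l i - t) ^ 2 + 2 * t * ∑ i, (l i - t) + d * t ^ 2 := by
    rw [Finset.mul_sum, ← Finset.sum_add_distrib]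
    have : (d : ℝ) * t ^ 2 = ∑ _i : Fin d, t ^ 2 := by simp
    rw [this, ← Finset.sum_add_distrib]
    exact Finset.sum_congr rfl fun i _ => by ring
  rw [this, h0]
  have : 0 ≤ (d : ℝ) * t ^ 2 := by positivity
  linarith

namespace IsUniformSphere

variable {d : ℕ} {σ : Measure (Fin d → ℂ)}

lemma integral_comp_qexp (hσ : IsUniformSphere d σ) {A : Matrix (Fin d) (Fin d) ℂ}
    (hA : A.IsHermitian) {f : ℝ → ℝ} (hf : Continuous f) :
    ∫ v, f (qexp A v).re ∂σ = ∫ v, f (diagForm hA.eigenvalues v) ∂σ := by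
  simp only [qexp_re_eq_diagForm_eigenvalues hA]
  exact hσ.integral_comp_mulVec (star hA.eigenvectorUnitary).2
    (f := fun v => f (diagForm hA.eigenvalues v)) (by fun_prop)

/-- Moments of a Hermitian observable about its uniform mean. -/
lemma integral_qexp_sub_mean_pow_le (hσ : IsUniformSphere d σ) (hd : 0 < d)
    {A : Matrix (Fin d) (Fin d) ℂ} (hA : A.IsHermitian) {n : ℕ} (hn : 0 < n) :
    ∫ v, ((qexp A v).re - (∑ i, hA.eigenvalues i) / d) ^ n ∂σ ≤ (n * hsNorm A / d) ^ n := by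
  rw [hσ.integral_comp_qexp hA (f := fun x => (x - (∑ i, hA.eigenvalues i) / d) ^ n) (by fun_prop)]
  refine le_trans (le_of_eq ?_) ((le_abs_self _).trans (hσ.abs_integral_diagForm_pow_le hd
    (Real.sqrt_nonneg _) (sum_sub_mean hd hA.eigenvalues)
    ((sum_sq_sub_mean_le hd hA.eigenvalues).trans (sum_sq_eigenvalues hA).le) hn))
  refine integral_congr_ae ?_
  filter_upwards [hσ.ae_norm2] with v hv
  rw [diagForm_sub_const _ _ hv]

lemma integral_mul_le_of_integral_sq_le (hσ : IsUniformSphere d σ) {w f : (Fin d → ℂ) → ℝ}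
    (hw : Continuous w) (hf : Continuous f) {c : ℝ} (hc : 0 ≤ c) (hw2 : ∫ v, w v ^ 2 ∂σ ≤ 2)
    (hf2 : ∫ v, f v ^ 2 ∂σ ≤ c ^ 2) : ∫ v, w v * f v ∂σ ≤ 2 * c := by
  refine le_of_forall_pos_le_add fun ε hε => ?_
  obtain ⟨b, hb⟩ : ∃ b, b = c + ε / 2 := ⟨_, rfl⟩
  have hbpos : 0 < b := by linarith
  have h : 0 ≤ ∫ v, (b ^ 2 * w v ^ 2 - 2 * b * (w v * f v) + f v ^ 2) ∂σ :=
    integral_nonneg fun v => by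
      have : b ^ 2 * w v ^ 2 - 2 * b * (w v * f v) + f v ^ 2 = (b * w v - f v) ^ 2 := by ring
      simp only [this]
      exact sq_nonneg _
  rw [integral_add (hσ.integrable (by fun_prop)) (hσ.integrable (by fun_prop)),
    integral_sub (hσ.integrable (by fun_prop)) (hσ.integrable (by fun_prop)),
    integral_const_mul, integral_const_mul] at h
  have hcb : c ^ 2 ≤ b ^ 2 := pow_le_pow_left₀ hc (by linarith) 2
  have h3 : b * (∫ v, w v * f v ∂σ) ≤ b * (2 * b) := by nlinarith [sq_nonneg b]
  have := le_of_mul_le_mul_left h3 hbpos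
  linarith

lemma lintegral_uniformPOVMDist (hσ : IsUniformSphere d σ) {ρ : Matrix (Fin d) (Fin d) ℂ}
    (hρ : ρ.PosSemidef) {f : (Fin d → ℂ) → ℝ} (hf : Continuous f) (hf0 : ∀ v, 0 ≤ f v) :
    ∫⁻ v, ENNReal.ofReal (f v) ∂(uniformPOVMDist d σ ρ) =
      ENNReal.ofReal (∫ v, d * (qexp ρ v).re * f v ∂σ) := by
  have hw : ∀ v, 0 ≤ (d : ℝ) * (qexp ρ v).re := fun v =>
    mul_nonneg (Nat.cast_nonneg d) (Complex.le_def.1 (hρ.dotProduct_mulVec_nonneg v)).1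
  have hm : Measurable fun v => ENNReal.ofReal (d * (qexp ρ v).re) :=
    Measurable.ennreal_ofReal (Continuous.measurable (by fun_prop))
  rw [uniformPOVMDist, lintegral_withDensity_eq_lintegral_mul _ hm hf.measurable.ennreal_ofReal,
    ofReal_integral_eq_lintegral_ofReal (hσ.integrable (by fun_prop))
      (Filter.Eventually.of_forall fun v => mul_nonneg (hw v) (hf0 v))]
  exact lintegral_congr fun v => (ENNReal.ofReal_mul (hw v)).symm

lemma integral_uniformPOVMDist {ρ : Matrix (Fin d) (Fin d) ℂ}
    (hρ : ρ.PosSemidef) (f : (Fin d → ℂ) → ℝ) :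
    ∫ v, f v ∂(uniformPOVMDist d σ ρ) = ∫ v, d * (qexp ρ v).re * f v ∂σ := by
  have hw : ∀ v, 0 ≤ (d : ℝ) * (qexp ρ v).re := fun v =>
    mul_nonneg (Nat.cast_nonneg d) (Complex.le_def.1 (hρ.dotProduct_mulVec_nonneg v)).1
  have hm : Measurable fun v => ENNReal.ofReal (d * (qexp ρ v).re) :=
    Measurable.ennreal_ofReal (Continuous.measurable (by fun_prop))
  rw [uniformPOVMDist, integral_withDensity_eq_integral_toReal_smul hm
    (Filter.Eventually.of_forall fun v => ENNReal.ofReal_lt_top)]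
  simp only [ENNReal.toReal_ofReal (hw _), smul_eq_mul]

lemma sum_eigenvalues_eq_one {ρ : Matrix (Fin d) (Fin d) ℂ} (hρ : ρ.IsHermitian)
    (h1 : ρ.trace = 1) : ∑ i, hρ.eigenvalues i = 1 := by
  have h := hρ.trace_eq_sum_eigenvalues
  rw [h1] at h
  have := congrArg Complex.re h
  simpa using this.symm

lemma integral_density (hσ : IsUniformSphere d σ) {ρ : Matrix (Fin d) (Fin d) ℂ}
    (hρ : ρ.IsHermitian) (h1 : ρ.trace = 1) : ∫ v, d * (qexp ρ v).re ∂σ = 1 := by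
  rw [integral_const_mul, hσ.integral_comp_qexp hρ (f := fun x => x) continuous_id,
    hσ.integral_diagForm, sum_eigenvalues_eq_one hρ h1]

lemma integral_density_sq_le (hσ : IsUniformSphere d σ) {ρ : Matrix (Fin d) (Fin d) ℂ}
    (hρ : ρ.PosSemidef) (h1 : ρ.trace = 1) : ∫ v, (d * (qexp ρ v).re) ^ 2 ∂σ ≤ 2 := by
  rw [hσ.integral_comp_qexp hρ.isHermitian (f := fun x => (d * x) ^ 2) (by fun_prop)]
  exact hσ.integral_sq_diagForm_le hρ.eigenvalues_nonneg (sum_eigenvalues_eq_one _ h1)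

end IsUniformSphere

/-- Bounded central moments of the uniform-POVM outcome distribution: there is a universal
constant `C' > 0` such that for every `h ≥ 2`, every state `ρ` on `ℂ^d` and every Hermitian
`O`, the `h`-th central moment of `⟨v|O|v⟩` under `D(ρ)` is at most
`(C'·h·‖O‖_HS/(d+1))^h`. -/
theorem uniformPOVM_central_moment_bound :
    ∃ C' : ℝ, 0 < C' ∧
      ∀ (h : ℕ), 2 ≤ h →
      ∀ (d : ℕ), 0 < d →
      ∀ σ : Measure (Fin d → ℂ), IsUniformSphere d σ →
      ∀ ρ : Matrix (Fin d) (Fin d) ℂ, ρ.PosSemidef → ρ.trace = 1 →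
      ∀ O : Matrix (Fin d) (Fin d) ℂ, O.IsHermitian →
        (∫⁻ v, ENNReal.ofReal
            (|(qexp O v).re - ∫ w, (qexp O w).re ∂(uniformPOVMDist d σ ρ)| ^ h)
            ∂(uniformPOVMDist d σ ρ)) ≤
          ENNReal.ofReal ((C' * h * hsNorm O / ((d : ℝ) + 1)) ^ h) := by
  refine ⟨48, by norm_num, fun h hh d hd σ hσ ρ hρ hρ1 O hO => ?_⟩
  set m := ∫ w, (qexp O w).re ∂(uniformPOVMDist d σ ρ) with hm
  set t : ℝ := (∑ i, hO.eigenvalues i) / d with ht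
  set S := hsNorm O with hS
  have hS0 : 0 ≤ S := Real.sqrt_nonneg _
  have hd0 : (0 : ℝ) < d := Nat.cast_pos.2 hd
  have hd1 : (1 : ℝ) ≤ d := by exact_mod_cast hd
  have hh2 : (2 : ℝ) ≤ h := by exact_mod_cast hh
  have hw : Continuous fun v : Fin d → ℂ => (d : ℝ) * (qexp ρ v).re := by fun_prop
  have hX : Continuous fun v : Fin d → ℂ => (qexp O v).re - t := by fun_prop
  have hw1 := hσ.integral_density hρ.isHermitian hρ1
  have hw2 := hσ.integral_density_sq_le hρ hρ1
  have hm_eq : m - t = ∫ v, d * (qexp ρ v).re * ((qexp O v).re - t) ∂σ := by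
    simp only [mul_sub]
    rw [integral_sub (hσ.integrable (by fun_prop)) (hσ.integrable (by fun_prop)),
      integral_mul_const, hw1, one_mul, hm, IsUniformSphere.integral_uniformPOVMDist hρ]
  have hX2 := hσ.integral_qexp_sub_mean_pow_le hd hO (n := 2) two_pos
  have hXh := hσ.integral_qexp_sub_mean_pow_le hd hO (n := h * 2) (by omega)
  rw [← ht, ← hS] at hX2 hXh
  set c : ℝ := h * 2 * S / d with hc
  have hc0 : 0 ≤ c := by positivity
  have hSc : 2 * S / d ≤ c := by
    rw [hc]
    gcongr
    linarith
  have hmt : |m - t| ≤ 2 * c := by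
    have h1 := hσ.integral_mul_le_of_integral_sq_le hw hX (c := 2 * S / d) (by positivity) hw2
      (by exact_mod_cast hX2)
    have h2 := hσ.integral_mul_le_of_integral_sq_le hw hX.neg (c := 2 * S / d) (by positivity) hw2
      (by simp only [Pi.neg_apply, neg_sq]; exact_mod_cast hX2)
    simp only [Pi.neg_apply, mul_neg, integral_neg] at h2
    rw [← hm_eq] at h1 h2
    rw [abs_le]
    constructor <;> linarith
  have habs := hσ.integral_mul_le_of_integral_sq_le hw (hX.abs.pow h) (c := c ^ h) (by positivity)
    hw2 (by
      simp only [Pi.pow_apply, ← pow_mul, (even_two.mul_left h).pow_abs]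
      simpa [hc] using hXh)
  rw [hσ.lintegral_uniformPOVMDist hρ (by fun_prop) (fun v => by positivity)]
  refine ENNReal.ofReal_le_ofReal ?_
  have hpt : ∀ v, (d : ℝ) * (qexp ρ v).re * |(qexp O v).re - m| ^ h ≤
      2 ^ h * (d * (qexp ρ v).re * |(qexp O v).re - t| ^ h)
        + 2 ^ h * (2 * c) ^ h * (d * (qexp ρ v).re) := fun v => by
    have hwv : 0 ≤ (d : ℝ) * (qexp ρ v).re :=
      mul_nonneg (Nat.cast_nonneg d) (Complex.le_def.1 (hρ.dotProduct_mulVec_nonneg v)).1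
    have h1 : |(qexp O v).re - m| ≤ |(qexp O v).re - t| + 2 * c := by
      have := abs_sub_le (qexp O v).re t m
      rw [abs_sub_comm t m] at this
      linarith
    have h2 : |(qexp O v).re - m| ^ h ≤ 2 ^ h * (|(qexp O v).re - t| ^ h + (2 * c) ^ h) :=
      (pow_le_pow_left₀ (abs_nonneg _) h1 h).trans
        ((add_pow_le (abs_nonneg _) (by positivity) h).trans
          (mul_le_mul_of_nonneg_right (pow_le_pow_right₀ one_le_two (Nat.sub_le h 1))
            (by positivity)))
    calc _ ≤ (d : ℝ) * (qexp ρ v).re * (2 ^ h * (|(qexp O v).re - t| ^ h + (2 * c) ^ h)) :=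
          mul_le_mul_of_nonneg_left h2 hwv
      _ = _ := by ring
  have hcd : c ≤ 4 * h * S / (d + 1) := by
    rw [hc, div_le_div_iff₀ hd0 (by positivity)]
    have : 0 ≤ (h : ℝ) * S := by positivity
    nlinarith
  calc _ ≤ ∫ v, (2 ^ h * (d * (qexp ρ v).re * |(qexp O v).re - t| ^ h)
        + 2 ^ h * (2 * c) ^ h * (d * (qexp ρ v).re)) ∂σ :=
        integral_mono (hσ.integrable (by fun_prop)) (hσ.integrable (by fun_prop)) hpt
    _ = 2 ^ h * ∫ v, d * (qexp ρ v).re * |(qexp O v).re - t| ^ h ∂σ + 2 ^ h * (2 * c) ^ h := by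
        rw [integral_add (hσ.integrable (by fun_prop)) (hσ.integrable (by fun_prop)),
          integral_const_mul, integral_const_mul, hw1, mul_one]
    _ ≤ 2 ^ h * (2 * c ^ h) + 2 ^ h * (2 * c) ^ h := by
        gcongr
        exact habs
    _ ≤ 3 ^ h * (4 * c) ^ h := by
        have e1 : (2 : ℝ) ≤ 2 ^ h := le_self_pow₀ one_le_two (by omega)
        have e3 : (2 : ℝ) ≤ 3 ^ h := e1.trans (pow_le_pow_left₀ (by norm_num) (by norm_num) h)
        have hch : 0 ≤ c ^ h := by positivity
        have e4 : (4 : ℝ) ^ h = 2 ^ h * 2 ^ h := by rw [← mul_pow]; norm_num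
        rw [mul_pow, mul_pow, e4]
        have : (2 : ℝ) ^ h * (2 * c ^ h) ≤ 2 ^ h * (2 ^ h * c ^ h) := by gcongr
        have : 2 * (2 ^ h * 2 ^ h * c ^ h) ≤ 3 ^ h * (2 ^ h * 2 ^ h * c ^ h) :=
          mul_le_mul_of_nonneg_right e3 (by positivity)
        linarith
    _ = (12 * c) ^ h := by rw [← mul_pow]; ring
    _ ≤ (48 * h * S / (d + 1)) ^ h := by
        refine pow_le_pow_left₀ (by positivity) ?_ h
        calc 12 * c ≤ 12 * (4 * h * S / (d + 1)) := by gcongr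
          _ = _ := by ring

end
end

section
/- There exists a universal constant C > 0 such that for every integer h ≥ 2, every positive integer d, every quantum state ρ on ℂ^d, and every Hermitian matrix O ∈ ℂ^{d×d}: (∫ ⟨v|O|v⟩^h dD(ρ)(v))² ≤ ((C·h)^{2h} / d^{2h}) · (Tr(O²) + (Tr O)²)^h. -/
open Matrix MeasureTheory
open scoped ComplexOrder

noncomputable section

section Moments

open scoped Matrix.Norms.Frobenius MatrixOrder

variable {d : ℕ}

/-- `qexp` at a fixed vector, as a linear functional of the matrix. -/
def qexpLin (v : Fin d → ℂ) : Matrix (Fin d) (Fin d) ℂ →ₗ[ℂ] ℂ where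
  toFun A := qexp A v
  map_add' A B := by simp [qexp, add_mulVec, dotProduct_add]
  map_smul' c A := by simp [qexp, smul_mulVec, dotProduct_smul]

theorem qexpLin_apply (v : Fin d → ℂ) (A : Matrix (Fin d) (Fin d) ℂ) : qexpLin v A = qexp A v :=
  rfl

theorem qexp_mulVec (U A : Matrix (Fin d) (Fin d) ℂ) (v : Fin d → ℂ) :
    qexp A (U *ᵥ v) = qexp (Uᴴ * A * U) v := by
  simp only [qexp, star_mulVec, ← mulVec_mulVec, dotProduct_mulVec, vecMul_vecMul]

theorem Matrix.IsHermitian.qexp_eq_re {A : Matrix (Fin d) (Fin d) ℂ} (hA : A.IsHermitian)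
    (v : Fin d → ℂ) : qexp A v = (qexp A v).re := by
  refine (Complex.conj_eq_iff_re.mp ?_).symm
  rw [starRingEnd_apply, qexp, ← star_dotProduct, star_mulVec, hA.eq, dotProduct_mulVec]

theorem qexp_eq_sum (A : Matrix (Fin d) (Fin d) ℂ) (v : Fin d → ℂ) :
    qexp A v = ∑ i, ∑ j, star (v i) * A i j * v j := by
  simp only [qexp, dotProduct, mulVec, Finset.mul_sum, Pi.star_apply, mul_assoc]

theorem continuous_qexp_s8 : Continuous fun p : Matrix (Fin d) (Fin d) ℂ × (Fin d → ℂ) =>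
    qexp p.1 p.2 := by
  simp only [qexp_eq_sum]
  refine continuous_finsetSum _ fun i _ => continuous_finsetSum _ fun j _ => ?_
  exact ((by fun_prop : Continuous fun p : Matrix (Fin d) (Fin d) ℂ × (Fin d → ℂ) =>
    star (p.2 i)).mul (continuous_fst.matrix_elem i j)).mul (by fun_prop)

theorem Continuous.qexp {α : Type*} [TopologicalSpace α] {A : α → Matrix (Fin d) (Fin d) ℂ}
    {v : α → Fin d → ℂ} (hA : Continuous A) (hv : Continuous v) :
    Continuous fun a => qexp (A a) (v a) :=
  continuous_qexp_s8.comp (hA.prodMk hv)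

theorem isCompact_norm2_eq_one : IsCompact {v : Fin d → ℂ | norm2 v = 1} := by
  refine Metric.isCompact_of_isClosed_isBounded ?_ ?_
  · refine isClosed_eq ?_ continuous_const
    unfold norm2
    exact continuous_finsetSum _ fun i _ => Complex.continuous_normSq.comp (continuous_apply i)
  · refine (Metric.isBounded_closedBall (x := (0 : Fin d → ℂ)) (r := 1)).subset fun v hv => ?_
    rw [mem_closedBall_zero_iff, pi_norm_le_iff_of_nonneg zero_le_one]
    intro i
    have h : Complex.normSq (v i) ≤ norm2 v :=
      Finset.single_le_sum (f := fun i => Complex.normSq (v i))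
        (fun j _ => Complex.normSq_nonneg _) (Finset.mem_univ i)
    rw [Set.mem_ofPred_eq.mp hv, Complex.normSq_eq_norm_sq] at h
    exact (sq_le_one_iff₀ (norm_nonneg _)).mp h

theorem IsUniformSphere.ae_norm2_s8 {σ : Measure (Fin d → ℂ)} (hσ : IsUniformSphere d σ) :
    ∀ᵐ v ∂σ, norm2 v = 1 :=
  mem_ae_iff.mpr hσ.2.1

theorem IsUniformSphere.integrable_s8 {σ : Measure (Fin d → ℂ)} (hσ : IsUniformSphere d σ)
    {f : (Fin d → ℂ) → ℂ} (hf : Continuous f) : Integrable f σ := by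
  have := hσ.1
  obtain ⟨K, hK⟩ := isCompact_norm2_eq_one.exists_bound_of_continuousOn hf.continuousOn
  exact Integrable.of_bound hf.aestronglyMeasurable K (hσ.ae_norm2_s8.mono fun v hv => hK v hv)

/-- The directional derivative at `(X, O)` of `qexp X v * qexp O v ^ n` along conjugation by the
one-parameter group generated by `H`. -/
def conjDeriv (H X O : Matrix (Fin d) (Fin d) ℂ) (n : ℕ) (v : Fin d → ℂ) : ℂ :=
  qexp (X * H - H * X) v * qexp O v ^ n +
    qexp X v * (n * qexp O v ^ (n - 1) * qexp (O * H - H * O) v)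

theorem Continuous.conjDeriv {α : Type*} [TopologicalSpace α]
    (H : Matrix (Fin d) (Fin d) ℂ) {X O : α → Matrix (Fin d) (Fin d) ℂ}
    {v : α → Fin d → ℂ} (n : ℕ) (hX : Continuous X) (hO : Continuous O) (hv : Continuous v) :
    Continuous fun a => conjDeriv H (X a) (O a) n (v a) :=
  ((((hX.mul continuous_const).sub (continuous_const.mul hX)).qexp hv).mul
    ((hO.qexp hv).pow n)).add ((hX.qexp hv).mul ((continuous_const.mul
      ((hO.qexp hv).pow (n - 1))).mul
        (((hO.mul continuous_const).sub (continuous_const.mul hO)).qexp hv)))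

/-- Conjugation of `A` by `exp (t • H)`. -/
def expConj (H A : Matrix (Fin d) (Fin d) ℂ) (t : ℝ) : Matrix (Fin d) (Fin d) ℂ :=
  NormedSpace.exp (t • -H) * A * NormedSpace.exp (t • H)

theorem expConj_zero (H A : Matrix (Fin d) (Fin d) ℂ) : expConj H A 0 = A := by
  simp [expConj]

theorem hasDerivAt_expConj (H A : Matrix (Fin d) (Fin d) ℂ) (t : ℝ) :
    HasDerivAt (expConj H A) (expConj H A t * H - H * expConj H A t) t := by
  have h := ((hasDerivAt_exp_smul_const' (𝕂 := ℝ) (-H) t).mul_const A).mul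
    (hasDerivAt_exp_smul_const (𝕂 := ℝ) H t)
  refine h.congr_deriv ?_
  simp only [expConj, mul_assoc, neg_mul]
  exact neg_add_eq_sub _ _

theorem hasDerivAt_qexp {A : ℝ → Matrix (Fin d) (Fin d) ℂ} {A' : Matrix (Fin d) (Fin d) ℂ}
    {t : ℝ} (hA : HasDerivAt A A' t) (v : Fin d → ℂ) :
    HasDerivAt (fun t => qexp (A t) v) (qexp A' v) t :=
  (((qexpLin v).restrictScalars ℝ).toContinuousLinearMap.hasFDerivAt.comp_hasDerivAt t hA :)

theorem integral_conjDeriv_of_skew {σ : Measure (Fin d → ℂ)} (hσ : IsUniformSphere d σ)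
    {H : Matrix (Fin d) (Fin d) ℂ} (hH : Hᴴ = -H) (X O : Matrix (Fin d) (Fin d) ℂ) (n : ℕ) :
    ∫ v, conjDeriv H X O n v ∂σ = 0 := by
  have := hσ.1
  have hc (A : Matrix (Fin d) (Fin d) ℂ) : Continuous (expConj H A) :=
    continuous_iff_continuousAt.mpr fun t => (hasDerivAt_expConj H A t).continuousAt
  let F : ℝ → (Fin d → ℂ) → ℂ := fun t v => qexp (expConj H X t) v * qexp (expConj H O t) v ^ n
  let F' : ℝ → (Fin d → ℂ) → ℂ := fun t v => conjDeriv H (expConj H X t) (expConj H O t) n v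
  have hF (t : ℝ) : Continuous (F t) :=
    (continuous_const.qexp continuous_id).mul ((continuous_const.qexp continuous_id).pow n)
  have hF' : Continuous fun p : ℝ × (Fin d → ℂ) => F' p.1 p.2 :=
    Continuous.conjDeriv H n ((hc X).comp continuous_fst) ((hc O).comp continuous_fst)
      continuous_snd
  have hconst (t : ℝ) : ∫ v, F t v ∂σ = ∫ v, F 0 v ∂σ := by
    have hU : NormedSpace.exp (t • H) ∈ Matrix.unitaryGroup (Fin d) ℂ := by
      refine NormedSpace.exp_mem_unitary_of_mem_skewAdjoint ?_
      rw [skewAdjoint.mem_iff, star_eq_conjTranspose, conjTranspose_smul, hH]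
      simp
    have hUm : Continuous fun v : Fin d → ℂ => NormedSpace.exp (t • H) *ᵥ v := by fun_prop
    have hstar : (NormedSpace.exp (t • H))ᴴ = NormedSpace.exp (t • -H) := by
      rw [← exp_conjTranspose, conjTranspose_smul, hH]
      simp
    conv_rhs => rw [← hσ.2.2 _ hU]
    rw [integral_map hUm.aemeasurable (hF 0).aestronglyMeasurable]
    simp only [F, qexp_mulVec, expConj_zero, hstar]
    rfl
  obtain ⟨K, hK⟩ := ((isCompact_Icc (a := (-1 : ℝ)) (b := 1)).prod
    (isCompact_norm2_eq_one (d := d))).exists_bound_of_continuousOn hF'.continuousOn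
  have hder := (hasDerivAt_integral_of_dominated_loc_of_deriv_le (μ := σ) (F := F) (F' := F')
    (x₀ := (0 : ℝ)) (bound := fun _ => K) (Icc_mem_nhds (by norm_num) (by norm_num))
    (.of_forall fun t => (hF t).aestronglyMeasurable) (hσ.integrable_s8 (hF 0))
    (hF'.comp (by fun_prop : Continuous fun v : Fin d → ℂ => ((0 : ℝ), v))).aestronglyMeasurable
    (hσ.ae_norm2_s8.mono fun v hv t ht => hK (t, v) ⟨ht, hv⟩) (integrable_const K)
    (.of_forall fun v t _ => (hasDerivAt_qexp (hasDerivAt_expConj H X t) v).mul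
      ((hasDerivAt_qexp (hasDerivAt_expConj H O t) v).pow n))).2
  simp only [hconst] at hder
  simpa [F', expConj_zero] using hder.unique (hasDerivAt_const _ _)

theorem conjDeriv_add_smul (H K X O : Matrix (Fin d) (Fin d) ℂ) (c : ℂ) (n : ℕ) (v : Fin d → ℂ) :
    conjDeriv (H + c • K) X O n v = conjDeriv H X O n v + c * conjDeriv K X O n v := by
  have h (A : Matrix (Fin d) (Fin d) ℂ) : qexp (A * (H + c • K) - (H + c • K) * A) v =
      qexp (A * H - H * A) v + c * qexp (A * K - K * A) v := by
    rw [← qexpLin_apply, ← qexpLin_apply, ← qexpLin_apply, ← smul_eq_mul (a := c), ← map_smul,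
      ← map_add]
    congr 1
    simp only [mul_add, add_mul, mul_smul_comm, smul_mul_assoc, smul_sub]
    abel
  simp only [conjDeriv, h]
  ring

theorem integral_conjDeriv {σ : Measure (Fin d → ℂ)} (hσ : IsUniformSphere d σ)
    (H X O : Matrix (Fin d) (Fin d) ℂ) (n : ℕ) : ∫ v, conjDeriv H X O n v ∂σ = 0 := by
  have hc (K : Matrix (Fin d) (Fin d) ℂ) : Continuous (conjDeriv K X O n) :=
    Continuous.conjDeriv K n continuous_const continuous_const continuous_id
  obtain ⟨K, L, hK, hL, rfl⟩ : ∃ K L : Matrix (Fin d) (Fin d) ℂ, Kᴴ = -K ∧ Lᴴ = -L ∧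
      H = K + Complex.I • L := by
    refine ⟨(1 / 2 : ℂ) • (H - Hᴴ), (-Complex.I / 2) • (H + Hᴴ), ?_, ?_, ?_⟩
    · simp [conjTranspose_smul, ← smul_neg]
    · simp [conjTranspose_smul, ← neg_smul, neg_div, add_comm]
    · rw [smul_smul, show Complex.I * (-Complex.I / 2) = (1 / 2 : ℂ) by
        linear_combination (-1 / 2 : ℂ) * Complex.I_mul_I, ← smul_add, sub_add_add_cancel,
        ← two_smul ℂ H, smul_smul]
      norm_num
  simp only [conjDeriv_add_smul]
  rw [integral_add (hσ.integrable_s8 (hc K)) ((hσ.integrable_s8 (hc L)).const_mul _),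
    integral_const_mul, integral_conjDeriv_of_skew hσ hK, integral_conjDeriv_of_skew hσ hL]
  simp

theorem qexp_one (v : Fin d → ℂ) : qexp 1 v = norm2 v := by
  simp only [qexp, one_mulVec, dotProduct, norm2, Complex.ofReal_sum, Complex.normSq_eq_conj_mul_self]
  rfl

theorem qexp_single_mul (a b : Fin d) (A : Matrix (Fin d) (Fin d) ℂ) (v : Fin d → ℂ) :
    qexp (single b a 1 * A) v = star (v b) * (A *ᵥ v) a := by
  rw [qexp, ← mulVec_mulVec, single_mulVec]
  simp [dotProduct, Function.update_apply]

theorem qexp_mul_single (a b : Fin d) (A : Matrix (Fin d) (Fin d) ℂ) (v : Fin d → ℂ) :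
    qexp (A * single a b 1) v = (star v ᵥ* A) a * v b := by
  rw [qexp, ← mulVec_mulVec, dotProduct_mulVec, single_mulVec]
  simp [dotProduct, Function.update_apply]

theorem sum_conjDeriv_single (B O : Matrix (Fin d) (Fin d) ℂ) (n : ℕ) {v : Fin d → ℂ}
    (hv : norm2 v = 1) :
    ∑ a, ∑ b, conjDeriv (single a b 1) (single b a 1 * B) O n v =
      B.trace * qexp O v ^ n + n * (qexp (O * B) v * qexp O v ^ (n - 1)) -
        (d * (qexp B v * qexp O v ^ n) + n * (qexp B v * (qexp O v ^ (n - 1) * qexp O v))) := by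
  have hp : ∑ b, star (v b) * v b = 1 := by
    have := qexp_one v
    rw [hv, qexp, one_mulVec] at this
    simpa [dotProduct] using this
  have hq (A : Matrix (Fin d) (Fin d) ℂ) : ∑ a, star (v a) * (A *ᵥ v) a = qexp A v := rfl
  have hx : ∑ a, (star v ᵥ* O) a * (B *ᵥ v) a = qexp (O * B) v := by
    rw [qexp, ← mulVec_mulVec, dotProduct_mulVec]
    rfl
  have hterm (a b : Fin d) : conjDeriv (single a b 1) (single b a 1 * B) O n v =
      B.diag a * qexp O v ^ n * (star (v b) * v b) - qexp O v ^ n * (star (v a) * (B *ᵥ v) a) +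
        n * qexp O v ^ (n - 1) * (((star v ᵥ* O) a * (B *ᵥ v) a) * (star (v b) * v b) -
          (star (v a) * (B *ᵥ v) a) * (star (v b) * (O *ᵥ v) b)) := by
    have h1 : qexp (single b a 1 * B * single a b 1) v = B.diag a * (star (v b) * v b) := by
      rw [mul_assoc, qexp_single_mul, ← mulVec_mulVec, single_mulVec, mulVec]
      simp [dotProduct, Function.update_apply]
      ring
    have h2 : qexp (single a b 1 * (single b a 1 * B)) v = star (v a) * (B *ᵥ v) a := by
      rw [← mul_assoc, single_mul_single_same, mul_one, qexp_single_mul]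
    rw [conjDeriv, ← qexpLin_apply, map_sub, qexpLin_apply, qexpLin_apply, h1, h2,
      ← qexpLin_apply v (O * _ - _), map_sub, qexpLin_apply, qexpLin_apply, qexp_mul_single,
      qexp_single_mul, qexp_single_mul]
    ring
  simp only [hterm, Finset.sum_add_distrib, Finset.sum_sub_distrib, ← Finset.mul_sum,
    ← Finset.sum_mul, hp, hq, hx, Finset.sum_const, Finset.card_univ, Fintype.card_fin,
    nsmul_eq_mul]
  simp only [mul_left_comm _ (d : ℂ), ← Finset.mul_sum, hq]
  rw [show ∑ a, B.diag a = B.trace from rfl]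
  ring

/-- Schwinger–Dyson recursion for the moments of the uniform measure on the complex sphere. -/
theorem integral_qexp_mul_pow {σ : Measure (Fin d → ℂ)} (hσ : IsUniformSphere d σ)
    (B O : Matrix (Fin d) (Fin d) ℂ) (n : ℕ) :
    (d + n) * ∫ v, qexp B v * qexp O v ^ n ∂σ =
      B.trace * ∫ v, qexp O v ^ n ∂σ + n * ∫ v, qexp (O * B) v * qexp O v ^ (n - 1) ∂σ := by
  have hq (A : Matrix (Fin d) (Fin d) ℂ) : Continuous (qexp A) :=
    continuous_const.qexp continuous_id
  have hsum : ∫ v, ∑ a, ∑ b, conjDeriv (single a b 1) (single b a 1 * B) O n v ∂σ = 0 := by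
    have hi (a b : Fin d) : Integrable (conjDeriv (single a b 1) (single b a 1 * B) O n) σ :=
      hσ.integrable_s8 (Continuous.conjDeriv _ n continuous_const continuous_const continuous_id)
    rw [integral_finsetSum _ fun a _ => integrable_finsetSum _ fun b _ => hi a b]
    refine Finset.sum_eq_zero fun a _ => ?_
    rw [integral_finsetSum _ fun b _ => hi a b]
    exact Finset.sum_eq_zero fun b _ => integral_conjDeriv hσ _ _ _ _
  have hpt : ∀ᵐ v ∂σ, ∑ a, ∑ b, conjDeriv (single a b 1) (single b a 1 * B) O n v =
      B.trace * qexp O v ^ n + n * (qexp (O * B) v * qexp O v ^ (n - 1)) -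
        (d + n) * (qexp B v * qexp O v ^ n) := by
    filter_upwards [hσ.ae_norm2_s8] with v hv
    rw [sum_conjDeriv_single B O n hv]
    rcases n with _ | n
    · simp
    · simp only [Nat.add_sub_cancel, pow_succ]
      ring
  rw [integral_congr_ae hpt, integral_sub, integral_add, integral_const_mul, integral_const_mul,
    integral_const_mul, sub_eq_zero] at hsum
  · exact hsum.symm
  all_goals exact hσ.integrable_s8 (by fun_prop)

theorem norm_integral_qexp_mul_pow_le {σ : Measure (Fin d → ℂ)} (hσ : IsUniformSphere d σ)
    (hd : 0 < d) (O : Matrix (Fin d) (Fin d) ℂ) {s : ℝ}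
    (hO : ∀ j : ℕ, ‖(O ^ (j + 1)).trace‖ ≤ s ^ (j + 1)) (n : ℕ)
    (B : Matrix (Fin d) (Fin d) ℂ) (c : ℝ) (hB : ∀ j : ℕ, ‖(O ^ j * B).trace‖ ≤ c * s ^ j) :
    ‖∫ v, qexp B v * qexp O v ^ n ∂σ‖ ≤ c * (n + 1).factorial * s ^ n / (d : ℝ) ^ (n + 1) := by
  have := hσ.1
  have hd' : (0 : ℝ) < d := by exact_mod_cast hd
  induction n generalizing B c with
  | zero =>
    have h := congrArg norm (integral_qexp_mul_pow hσ B O 0)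
    simp only [Nat.cast_zero, add_zero, pow_zero, mul_one, integral_const, probReal_univ, one_smul,
      zero_mul, norm_mul, Complex.norm_natCast] at h
    have hB0 := hB 0
    simp only [pow_zero, one_mul, mul_one] at hB0
    simp only [pow_zero, mul_one, zero_add, Nat.factorial_one, Nat.cast_one, pow_one]
    rw [le_div_iff₀ hd']
    linarith
  | succ n ih =>
    have h := congrArg norm (integral_qexp_mul_pow hσ B O (n + 1))
    have hB0 := hB 0
    simp only [pow_zero, one_mul, mul_one] at hB0
    have h1 := ih O s fun j => by
      rw [← pow_succ, ← pow_succ']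
      exact hO j
    have h2 := ih (O * B) (c * s) fun j => by
      rw [← mul_assoc, ← pow_succ, mul_assoc c, ← pow_succ']
      exact hB (j + 1)
    simp only [← pow_succ'] at h1
    rw [Nat.add_sub_cancel, norm_mul] at h
    have hdn : ‖(d : ℂ) + ((n + 1 : ℕ) : ℂ)‖ = (d : ℝ) + (n + 1) := by
      rw [← Nat.cast_add, Complex.norm_natCast]
      push_cast
      ring
    rw [hdn] at h
    set I := ∫ v, qexp B v * qexp O v ^ (n + 1) ∂σ
    have hle := norm_add_le (B.trace * ∫ v, qexp O v ^ (n + 1) ∂σ)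
      (((n + 1 : ℕ) : ℂ) * ∫ v, qexp (O * B) v * qexp O v ^ n ∂σ)
    rw [← h, norm_mul, norm_mul, Complex.norm_natCast] at hle
    have hc : 0 ≤ c := (norm_nonneg _).trans hB0
    have h3 : ‖B.trace‖ * ‖∫ v, qexp O v ^ (n + 1) ∂σ‖ ≤
        c * (s * (n + 1).factorial * s ^ n / (d : ℝ) ^ (n + 1)) := by gcongr
    have h4 : ((n + 1 : ℕ) : ℝ) * ‖∫ v, qexp (O * B) v * qexp O v ^ n ∂σ‖ ≤
        ((n + 1 : ℕ) : ℝ) * (c * s * (n + 1).factorial * s ^ n / (d : ℝ) ^ (n + 1)) := by gcongr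
    have h5 : d * ‖I‖ ≤ (d + (n + 1)) * ‖I‖ := by
      gcongr
      linarith [(Nat.cast_nonneg n : (0 : ℝ) ≤ n)]
    have h6 : c * (n + 1 + 1).factorial * s ^ (n + 1) / (d : ℝ) ^ (n + 1 + 1) =
        (c * (s * (n + 1).factorial * s ^ n / (d : ℝ) ^ (n + 1)) +
          ((n + 1 : ℕ) : ℝ) * (c * s * (n + 1).factorial * s ^ n / (d : ℝ) ^ (n + 1))) / d := by
      rw [Nat.factorial_succ (n + 1)]
      push_cast
      field_simp
      ring
    rw [h6, le_div_iff₀ hd']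
    linarith

theorem norm_trace_mul_le (A B : Matrix (Fin d) (Fin d) ℂ) : ‖(A * B).trace‖ ≤ ‖A‖ * ‖B‖ := by
  have hn (A : Matrix (Fin d) (Fin d) ℂ) : ‖A‖ = √(∑ p : Fin d × Fin d, ‖A p.1 p.2‖ ^ 2) := by
    rw [frobenius_norm_def, Real.sqrt_eq_rpow, Fintype.sum_prod_type]
    simp only [Real.rpow_ofNat]
  have htr : (A * B).trace = ∑ p : Fin d × Fin d, A p.1 p.2 * Bᵀ p.1 p.2 := by
    rw [Fintype.sum_prod_type]
    rfl
  rw [htr, ← frobenius_norm_transpose B, hn, hn]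
  refine (norm_sum_le _ _).trans ?_
  simp only [norm_mul]
  exact Real.sum_mul_le_sqrt_mul_sqrt _ _ _

theorem frobenius_norm_sq_eq_trace (A : Matrix (Fin d) (Fin d) ℂ) :
    ‖A‖ ^ 2 = ((Aᴴ * A).trace).re := by
  rw [frobenius_norm_def, ← Real.sqrt_eq_rpow, Real.sq_sqrt (by positivity), Finset.sum_comm]
  simp only [trace, diag_apply, mul_apply, conjTranspose_apply, Complex.re_sum, Real.rpow_ofNat]
  refine Finset.sum_congr rfl fun i _ => Finset.sum_congr rfl fun j _ => ?_
  rw [← Complex.normSq_eq_norm_sq, ← Complex.ofReal_re (Complex.normSq _),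
    Complex.normSq_eq_conj_mul_self]
  rfl

theorem Matrix.PosSemidef.frobenius_norm_le_trace {ρ : Matrix (Fin d) (Fin d) ℂ}
    (hρ : ρ.PosSemidef) : ‖ρ‖ ≤ ρ.trace.re := by
  obtain ⟨A, rfl⟩ := CStarAlgebra.nonneg_iff_eq_star_mul_self.mp (nonneg_iff_posSemidef.mpr hρ)
  rw [star_eq_conjTranspose, ← frobenius_norm_sq_eq_trace, sq]
  exact (frobenius_norm_mul _ _).trans_eq (by rw [frobenius_norm_conjTranspose])

theorem trace_bounds {ρ O : Matrix (Fin d) (Fin d) ℂ} (hρ : ρ.PosSemidef) (hρ1 : ρ.trace = 1)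
    (hO : O.IsHermitian) :
    (∀ j : ℕ, ‖(O ^ (j + 1)).trace‖ ≤ √((O * O).trace.re + O.trace.re ^ 2) ^ (j + 1)) ∧
      (∀ j : ℕ, ‖(O ^ j * ρ).trace‖ ≤ √((O * O).trace.re + O.trace.re ^ 2) ^ j) ∧
      √((O * O).trace.re + O.trace.re ^ 2) ^ 2 = (O * O).trace.re + O.trace.re ^ 2 := by
  have hn : ‖O‖ ^ 2 = (O * O).trace.re := by rw [frobenius_norm_sq_eq_trace, hO.eq]
  have hO1 : ‖O‖ ≤ √((O * O).trace.re + O.trace.re ^ 2) :=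
    Real.le_sqrt_of_sq_le (by rw [hn]; linarith [sq_nonneg O.trace.re])
  have hpow (j : ℕ) : ‖O ^ (j + 1)‖ ≤ √((O * O).trace.re + O.trace.re ^ 2) ^ (j + 1) :=
    (norm_pow_le' O j.succ_pos).trans (pow_le_pow_left₀ (norm_nonneg _) hO1 _)
  refine ⟨fun j => ?_, fun j => ?_, Real.sq_sqrt ?_⟩
  · rcases j with _ | j
    · have hre : O.trace = O.trace.re :=
        (Complex.conj_eq_iff_re.mp (by
          rw [starRingEnd_apply, ← trace_conjTranspose, hO.eq])).symm
      rw [zero_add, pow_one, pow_one, hre, Complex.norm_real, Complex.ofReal_re]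
      exact Real.le_sqrt_of_sq_le (by rw [Real.norm_eq_abs, sq_abs, ← hn]; linarith [sq_nonneg ‖O‖])
    · rw [pow_succ O, pow_succ (√_)]
      exact (norm_trace_mul_le _ _).trans (mul_le_mul (hpow j) hO1 (norm_nonneg _) (by positivity))
  · rcases j with _ | j
    · simp [hρ1]
    · have h := hρ.frobenius_norm_le_trace
      rw [hρ1, Complex.one_re] at h
      exact (norm_trace_mul_le _ _).trans
        ((mul_le_of_le_one_right (norm_nonneg _) h).trans (hpow j))
  · rw [← hn]
    positivity

end Moments

/-- Hypercontractivity of the uniform-POVM outcome distribution: there is a universal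
constant `C > 0` such that for all `h ≥ 2`, all states `ρ` on `ℂ^d` and all Hermitian `O`,
`(∫ ⟨v|O|v⟩^h dD(ρ)(v))² ≤ ((Ch)^{2h}/d^{2h})·(Tr(O²) + (Tr O)²)^h`. -/
theorem uniformPOVM_hypercontractive :
    ∃ C : ℝ, 0 < C ∧
      ∀ (h : ℕ), 2 ≤ h →
      ∀ (d : ℕ), 0 < d →
      ∀ σ : Measure (Fin d → ℂ), IsUniformSphere d σ →
      ∀ ρ : Matrix (Fin d) (Fin d) ℂ, ρ.PosSemidef → ρ.trace = 1 →
      ∀ O : Matrix (Fin d) (Fin d) ℂ, O.IsHermitian →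
        (∫ v, (qexp O v).re ^ h ∂(uniformPOVMDist d σ ρ)) ^ 2 ≤
          ((C * h) ^ (2 * h) / (d : ℝ) ^ (2 * h)) *
            (((O * O).trace.re) + (O.trace.re) ^ 2) ^ h := by
  refine ⟨2, two_pos, fun h hh d hd σ hσ ρ hρ hρ1 O hO => ?_⟩
  have hd' : (0 : ℝ) < d := by exact_mod_cast hd
  have hq (A : Matrix (Fin d) (Fin d) ℂ) : Continuous (qexp A) :=
    continuous_const.qexp continuous_id
  have hmeas : Measurable fun v => ENNReal.ofReal ((d : ℝ) * (qexp ρ v).re) :=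
    (continuous_const.mul (Complex.continuous_re.comp (hq ρ))).measurable.ennreal_ofReal
  have hint : ((∫ v, (qexp O v).re ^ h ∂(uniformPOVMDist d σ ρ) : ℝ) : ℂ) =
      d * ∫ v, qexp ρ v * qexp O v ^ h ∂σ := by
    rw [uniformPOVMDist, integral_withDensity_eq_integral_toReal_smul hmeas
      (.of_forall fun v => ENNReal.ofReal_lt_top), ← integral_complex_ofReal,
      ← integral_const_mul]
    refine integral_congr_ae (.of_forall fun v => ?_)
    have h0 : 0 ≤ (qexp ρ v).re := hρ.re_dotProduct_nonneg v
    simp only [ENNReal.toReal_ofReal (mul_nonneg hd'.le h0), smul_eq_mul]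
    rw [hO.qexp_eq_re v, hρ.1.qexp_eq_re v]
    push_cast
    simp only [Complex.ofReal_re]
    ring
  set s : ℝ := √((O * O).trace.re + O.trace.re ^ 2)
  obtain ⟨hOtr, hρtr, hs2⟩ := trace_bounds hρ hρ1 hO
  have hbound := norm_integral_qexp_mul_pow_le hσ hd O hOtr h ρ 1
    (by simpa only [one_mul] using hρtr)
  have hfac : ((h + 1).factorial : ℝ) ≤ (2 * h) ^ h := by
    have : (h + 1).factorial ≤ (2 * h) ^ h := by
      rw [Nat.factorial_succ, mul_pow]
      exact Nat.mul_le_mul Nat.lt_two_pow_self (Nat.factorial_le_pow h)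
    exact_mod_cast this
  have habs : |∫ v, (qexp O v).re ^ h ∂(uniformPOVMDist d σ ρ)| ≤
      (2 * h) ^ h / (d : ℝ) ^ h * s ^ h := by
    rw [← Real.norm_eq_abs, ← Complex.norm_real, hint, norm_mul, Complex.norm_natCast]
    calc (d : ℝ) * ‖∫ v, qexp ρ v * qexp O v ^ h ∂σ‖
        ≤ d * (1 * (h + 1).factorial * s ^ h / (d : ℝ) ^ (h + 1)) := by gcongr
      _ = (h + 1).factorial / (d : ℝ) ^ h * s ^ h := by
        field_simp
        ring
      _ ≤ _ := by gcongr
  calc _ = |∫ v, (qexp O v).re ^ h ∂(uniformPOVMDist d σ ρ)| ^ 2 := (sq_abs _).symm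
    _ ≤ ((2 * h) ^ h / (d : ℝ) ^ h * s ^ h) ^ 2 := by gcongr
    _ = _ := by
      rw [mul_pow, div_pow, ← pow_mul, ← pow_mul, ← pow_mul, mul_comm h 2, pow_mul s, hs2]

end
end
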